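/- Let A = (a_{ij}) ∈ M_n(ℝ₊) with a_{11} ≤ a_{22} ≤ ⋯ ≤ a_{nn}, and write its characteristic maxpolynomial as 𝒳_A(x) = x^n ⊕ δ_{i_1} x^{n−i_1} ⊕ δ_{i_2} x^{n−i_2} ⊕ ⋯ ⊕ δ_{i_t} x^{n−i_t}, where 1 ≤ i_1 < i_2 < ⋯ < i_t ≤ n are exactly the indices of the essential coefficients; set i_0 = 0 and δ_{i_0} = 1. Then for every 1 ≤ m ≤ t: (δ_{i_m}/δ_{i_{m−1}})^{1/(i_m − i_{m−1})} ≥ a_{n−i_{m−1}, n−i_{m−1}}. -/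

import Mathlib

open Matrix

/-- Max-algebra matrix product: `(A ⊗ B) i j = max_p (A i p * B p j)`. -/
noncomputable def maxMul {n m l : ℕ} (A : Matrix (Fin n) (Fin m) ℝ)
    (B : Matrix (Fin m) (Fin l) ℝ) : Matrix (Fin n) (Fin l) ℝ :=
  Matrix.of fun i j => ⨆ p, A i p * B p j

/-- Max trace: `tr⊗(A) = max_i A i i`. -/
noncomputable def trMax {n : ℕ} (A : Matrix (Fin n) (Fin n) ℝ) : ℝ := ⨆ i, A i i

/-- The set 𝒳_{n×k} of nonnegative `n×k` matrices with `Xᵀ ⊗ X = I_k`. -/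
def Xset (n k : ℕ) : Set (Matrix (Fin n) (Fin k) ℝ) :=
  {X | (∀ i j, 0 ≤ X i j) ∧ maxMul Xᵀ X = 1}

/-- The max `k`-numerical range `W_max^k(A) = { tr⊗(Xᵀ⊗A⊗X) : X ∈ 𝒳_{n×k} }`. -/
noncomputable def Wmax {n : ℕ} (k : ℕ) (A : Matrix (Fin n) (Fin n) ℝ) : Set ℝ :=
  {z | ∃ X ∈ Xset n k, z = trMax (maxMul (maxMul Xᵀ A) X)}

/-- Max permanent of the principal submatrix of `A` on a subset `S`. -/
noncomputable def maxPermSub {n : ℕ} (A : Matrix (Fin n) (Fin n) ℝ)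
    (S : Finset (Fin n)) : ℝ :=
  ⨆ σ : Equiv.Perm {x : Fin n // x ∈ S}, ∏ i : {x : Fin n // x ∈ S}, A i.1 (σ i).1

/-- Coefficient `δ_k(A)` of the characteristic maxpolynomial: `δ_0 = 1` and for
`1 ≤ k ≤ n`, `δ_k = max of the max permanents of all k×k principal submatrices`. -/
noncomputable def delta {n : ℕ} (A : Matrix (Fin n) (Fin n) ℝ) (k : ℕ) : ℝ :=
  if k = 0 then 1
  else ⨆ S : {S : Finset (Fin n) // S.card = k}, maxPermSub A S.1

/-- The coefficient `δ_i` of the characteristic maxpolynomial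
`𝒳_A(x) = max_{0 ≤ j ≤ n} δ_j x^{n−j}` (with `δ_0 = 1`) is *essential* if it is not
dominated by the other terms, i.e. there is some `x ≥ 0` where its term strictly
exceeds the maximum of all the other terms. -/
def Essential {n : ℕ} (A : Matrix (Fin n) (Fin n) ℝ) (i : ℕ) : Prop :=
  ∃ x : ℝ, 0 ≤ x ∧
    (⨆ j : {j : Fin (n + 1) // (j : ℕ) ≠ i}, delta A (j.1 : ℕ) * x ^ (n - (j.1 : ℕ))) <
      delta A i * x ^ (n - i)

lemma aux_perturb (n : ℕ) (d : ℕ → ℝ) (hd : ∀ k, 0 ≤ d k) (l : ℝ) (hl : 0 < l)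
    (j : ℕ) (hj : j ≤ n) (hpos : 0 < d j)
    (h1 : ∀ k, k < j → d k * l ^ (n - k) ≤ d j * l ^ (n - j))
    (h2 : ∀ k, j < k → k ≤ n → d k * l ^ (n - k) < d j * l ^ (n - j)) :
    ∃ x : ℝ, 0 < x ∧ ∀ k, k ≤ n → k ≠ j → d k * x ^ (n - k) < d j * x ^ (n - j) := by
  have ev0 : ∀ᶠ x in nhdsWithin l (Set.Iio l), 0 < x :=
    (lt_mem_nhds hl).filter_mono nhdsWithin_le_nhds
  have ev1 : ∀ᶠ x in nhdsWithin l (Set.Iio l), x < l := self_mem_nhdsWithin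
  have ev2 : ∀ᶠ x in nhdsWithin l (Set.Iio l),
      ∀ k ∈ Finset.Ioc j n, d k * x ^ (n - k) < d j * x ^ (n - j) := by
    rw [Filter.eventually_all_finset]
    intro k hk
    rw [Finset.mem_Ioc] at hk
    have hc1 : Continuous fun x : ℝ => d k * x ^ (n - k) := by fun_prop
    have hc2 : Continuous fun x : ℝ => d j * x ^ (n - j) := by fun_prop
    exact (hc1.continuousAt.eventually_lt hc2.continuousAt (h2 k hk.1 hk.2)).filter_mono
      nhdsWithin_le_nhds
  obtain ⟨x, hx0, hx1, hx2⟩ := (ev0.and (ev1.and ev2)).exists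
  refine ⟨x, hx0, fun k hk hkj => ?_⟩
  rcases lt_or_gt_of_ne hkj with h | h
  · have e1 : n - k = (j - k) + (n - j) := by omega
    have h3 := h1 k h
    rw [e1, pow_add, ← mul_assoc] at h3 ⊢
    have h4 : d k * l ^ (j - k) ≤ d j := le_of_mul_le_mul_right h3 (by positivity)
    refine mul_lt_mul_of_pos_right ?_ (by positivity)
    rcases (hd k).eq_or_lt with h0 | h0
    · rw [← h0]; simpa using hpos
    · have : x ^ (j - k) < l ^ (j - k) := pow_lt_pow_left₀ hx1 hx0.le (by omega)
      nlinarith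
  · exact hx2 k (Finset.mem_Ioc.2 ⟨h, hk⟩)

lemma aux_main (n : ℕ) (d : ℕ → ℝ) (hd : ∀ k, 0 ≤ d k) (p q : ℕ) (hpq : p < q) (hq : q ≤ n)
    (hdp : 0 < d p)
    (hp : 0 < p → ∃ x : ℝ, 0 ≤ x ∧ ∀ k, k ≤ n → k ≠ p → d k * x ^ (n - k) < d p * x ^ (n - p))
    (hqe : ∃ x : ℝ, 0 ≤ x ∧ ∀ k, k ≤ n → k ≠ q → d k * x ^ (n - k) < d q * x ^ (n - q))
    (hno : ∀ j, p < j → j < q → ¬ ∃ x : ℝ, 0 < x ∧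
      ∀ k, k ≤ n → k ≠ j → d k * x ^ (n - k) < d j * x ^ (n - j)) :
    d (p + 1) ≤ d p * (d q / d p) ^ (((q - p : ℕ) : ℝ)⁻¹) := by
  obtain ⟨y, hy0, hy⟩ := hqe
  have red : ∀ (a b : ℕ) (x : ℝ), a < b → b ≤ n →
      d a * x ^ (n - a) = d a * x ^ (b - a) * x ^ (n - b) := by
    intro a b x hab hb
    rw [mul_assoc, ← pow_add]; congr 2; omega
  have hdq : 0 < d q := by
    have := hy p (by omega) (by omega)
    have h0 : 0 ≤ d p * y ^ (n - p) := by positivity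
    exact pos_of_mul_pos_left (h0.trans_lt this) (by positivity)
  set l := (d q / d p) ^ (((q - p : ℕ) : ℝ)⁻¹) with hldef
  have hl : 0 < l := by positivity
  have hlpow : d p * l ^ (q - p) = d q := by
    rw [hldef, Real.rpow_inv_natCast_pow (by positivity) (by omega)]
    field_simp
  by_contra hcon
  push Not at hcon
  have hyl : y < l := by
    have h := hy p (by omega) (by omega)
    rw [red p q y hpq hq] at h
    have h2 := lt_of_mul_lt_mul_right h (by positivity)
    rw [← hlpow] at h2
    exact lt_of_pow_lt_pow_left₀ _ hl.le (lt_of_mul_lt_mul_left h2 hdp.le)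
  have teq : d p * l ^ (n - p) = d q * l ^ (n - q) := by
    rw [red p q l hpq hq, hlpow]
  have hlow : ∀ k, k < p → d k * l ^ (n - k) ≤ d p * l ^ (n - p) := by
    intro k hk
    obtain ⟨x, hx0, hx⟩ := hp (by omega)
    have hlx : l < x := by
      have h := hx q hq (by omega)
      rw [red p q x hpq hq, ← hlpow] at h
      have h2 := lt_of_mul_lt_mul_right h (by positivity)
      exact lt_of_pow_lt_pow_left₀ _ hx0 (lt_of_mul_lt_mul_left h2 hdp.le)
    have h := hx k (by omega) (by omega)
    rw [red k p x hk (by omega)] at h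
    have h2 := lt_of_mul_lt_mul_right h (by positivity)
    rw [red k p l hk (by omega)]
    refine mul_le_mul_of_nonneg_right ?_ (by positivity)
    refine le_trans (mul_le_mul_of_nonneg_left ?_ (hd k)) h2.le
    exact pow_le_pow_left₀ hl.le hlx.le _
  have hhigh : ∀ k, q < k → k ≤ n → d k * l ^ (n - k) ≤ d q * l ^ (n - q) := by
    intro k hk hkn
    have h := hy k hkn (by omega)
    rw [red q k y hk hkn] at h
    have h2 := lt_of_mul_lt_mul_right h (by positivity)
    rw [red q k l hk hkn]
    refine mul_le_mul_of_nonneg_right ?_ (by positivity)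
    refine le_trans h2.le (mul_le_mul_of_nonneg_left ?_ hdq.le)
    exact pow_le_pow_left₀ hy0 hyl.le _
  have hbig : d p * l ^ (n - p) < d (p + 1) * l ^ (n - (p + 1)) := by
    rw [red p (p + 1) l (by omega) (by omega)]
    refine mul_lt_mul_of_pos_right ?_ (by positivity)
    simpa using hcon
  -- the largest maximizing index
  obtain ⟨j0, hj0, hmax⟩ := Finset.exists_max_image (Finset.range (n + 1))
    (fun k => d k * l ^ (n - k)) ⟨0, by simp⟩
  obtain ⟨j, hj, hjmax⟩ := Finset.exists_max_image
    ((Finset.range (n + 1)).filter fun k => d k * l ^ (n - k) = d j0 * l ^ (n - j0)) id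
    ⟨j0, Finset.mem_filter.2 ⟨hj0, rfl⟩⟩
  simp only [Finset.mem_filter, Finset.mem_range, id] at hj hjmax hmax
  have hb : d p * l ^ (n - p) < d j * l ^ (n - j) := by
    rw [hj.2]; exact hbig.trans_le (hmax _ (by omega))
  have hjp : p < j := by
    by_contra h
    rcases (not_lt.1 h).eq_or_lt with h | h
    · rw [h] at hb; exact lt_irrefl _ hb
    · exact absurd (hlow j h) (not_le.2 hb)
  have hjq : j < q := by
    by_contra h
    rcases (not_lt.1 h).eq_or_lt with h | h
    · rw [← h, teq] at hb; exact lt_irrefl _ hb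
    · exact absurd (hhigh j h (by omega)) (not_le.2 (teq ▸ hb))
  refine hno j hjp hjq (aux_perturb n d hd l hl j (by omega) ?_ ?_ ?_)
  · have h0 : 0 ≤ d p * l ^ (n - p) := by positivity
    exact pos_of_mul_pos_left (h0.trans_lt hb) (by positivity)
  · intro k hk
    rw [hj.2]; exact hmax k (by omega)
  · intro k hk hkn
    rw [hj.2]
    refine lt_of_le_of_ne (hmax k (by omega)) fun h => ?_
    have := hjmax k ⟨by omega, h⟩
    omega

lemma aux_maxPermSub_nonneg {n : ℕ} (A : Matrix (Fin n) (Fin n) ℝ) (hA : ∀ i j, 0 ≤ A i j)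
    (S : Finset (Fin n)) : 0 ≤ maxPermSub A S :=
  Real.iSup_nonneg fun _ => Finset.prod_nonneg fun _ _ => hA _ _

lemma aux_delta_nonneg {n : ℕ} (A : Matrix (Fin n) (Fin n) ℝ) (hA : ∀ i j, 0 ≤ A i j)
    (k : ℕ) : 0 ≤ delta A k := by
  unfold delta
  split_ifs
  · exact zero_le_one
  · exact Real.iSup_nonneg fun S => aux_maxPermSub_nonneg A hA _

lemma aux_le_delta {n : ℕ} (A : Matrix (Fin n) (Fin n) ℝ) (S : Finset (Fin n))
    (τ : Equiv.Perm (Fin n)) (hτ : ∀ x, τ x ∈ S ↔ x ∈ S) (k : ℕ) (hS : S.card = k) (hk : k ≠ 0) :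
    ∏ x ∈ S, A x (τ x) ≤ delta A k := by
  have h1 : ∏ x ∈ S, A x (τ x) ≤ maxPermSub A S := by
    have := le_ciSup (f := fun σ : Equiv.Perm {x : Fin n // x ∈ S} =>
      ∏ i : {x : Fin n // x ∈ S}, A i.1 (σ i).1) (Set.finite_range _).bddAbove
      (τ.subtypePerm hτ)
    refine le_trans (le_of_eq ?_) this
    exact (Finset.prod_coe_sort S fun x => A x (τ x)).symm
  unfold delta
  rw [if_neg hk]
  exact h1.trans (le_ciSup (f := fun S : {S : Finset (Fin n) // S.card = k} => maxPermSub A S.1)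
    (Set.finite_range _).bddAbove ⟨S, hS⟩)

lemma aux_delta_eq {n : ℕ} (A : Matrix (Fin n) (Fin n) ℝ) (k : ℕ) (hk : k ≤ n) :
    ∃ (S : Finset (Fin n)) (τ : Equiv.Perm (Fin n)), S.card = k ∧ (∀ x, τ x ∈ S ↔ x ∈ S) ∧
      (∀ x, x ∉ S → τ x = x) ∧ delta A k = ∏ x ∈ S, A x (τ x) := by
  by_cases h0 : k = 0
  · exact ⟨∅, 1, by simp [h0], by simp, by simp, by simp [delta, h0]⟩
  obtain ⟨S0, hS0⟩ : ∃ S : Finset (Fin n), S.card = k := by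
    obtain ⟨S, -, h⟩ := Finset.exists_subset_card_eq (s := (Finset.univ : Finset (Fin n)))
      (n := k) (by simpa using hk)
    exact ⟨S, h⟩
  haveI : Nonempty {S : Finset (Fin n) // S.card = k} := ⟨⟨S0, hS0⟩⟩
  obtain ⟨⟨S, hS⟩, h1⟩ := exists_eq_ciSup_of_finite
    (f := fun S : {S : Finset (Fin n) // S.card = k} => maxPermSub A S.1)
  obtain ⟨σ, h2⟩ := exists_eq_ciSup_of_finite
    (f := fun σ : Equiv.Perm {x : Fin n // x ∈ S} =>
      ∏ i : {x : Fin n // x ∈ S}, A i.1 (σ i).1)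
  have hout : ∀ x, x ∉ S → Equiv.Perm.ofSubtype σ x = x := fun x hx =>
    Equiv.Perm.ofSubtype_apply_of_not_mem σ hx
  refine ⟨S, Equiv.Perm.ofSubtype σ, hS, fun x => ?_, hout, ?_⟩
  · by_cases hx : x ∈ S
    · rw [Equiv.Perm.ofSubtype_apply_of_mem σ hx]
      simp [hx]
    · rw [hout x hx]
  · unfold delta
    rw [if_neg h0, ← h1]
    unfold maxPermSub
    rw [← h2, ← Finset.prod_coe_sort S]
    refine Finset.prod_congr rfl fun i _ => ?_
    rw [Equiv.Perm.ofSubtype_apply_coe]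

lemma aux_step {n : ℕ} (A : Matrix (Fin n) (Fin n) ℝ) (hA : ∀ i j, 0 ≤ A i j)
    (hdiag : ∀ i j : Fin n, i ≤ j → A i i ≤ A j j) (p : ℕ) (hp : p < n) (a : Fin n)
    (ha : (a : ℕ) = n - 1 - p) :
    delta A p * A a a ≤ delta A (p + 1) := by
  obtain ⟨S, τ, hS, hτ, hout, hd⟩ := aux_delta_eq A p hp.le
  obtain ⟨i, hi, hiS⟩ : ∃ i ∈ Finset.Ici a, i ∉ S := by
    refine Finset.exists_mem_notMem_of_card_lt_card ?_
    rw [hS, Fin.card_Ici]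
    omega
  have h := aux_le_delta A (insert i S) τ (fun x => by
    by_cases hx : x = i
    · subst hx; simp [hout x hiS]
    · have : τ x ≠ i := fun h => hx (τ.injective (h.trans (hout i hiS).symm))
      simp [hx, this, hτ]) (p + 1) (by rw [Finset.card_insert_of_notMem hiS, hS]) (by omega)
  rw [Finset.prod_insert hiS, ← hd, hout i hiS, mul_comm] at h
  exact le_trans (mul_le_mul_of_nonneg_left (hdiag a i (Finset.mem_Ici.1 hi))
    (aux_delta_nonneg A hA p)) h

lemma aux_essential {n : ℕ} (A : Matrix (Fin n) (Fin n) ℝ) (i : ℕ) (h : Essential A i) :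
    ∃ x : ℝ, 0 ≤ x ∧ ∀ k, k ≤ n → k ≠ i →
      delta A k * x ^ (n - k) < delta A i * x ^ (n - i) := by
  obtain ⟨x, hx, h⟩ := h
  refine ⟨x, hx, fun k hk hki => lt_of_le_of_lt ?_ h⟩
  exact le_ciSup (f := fun j : {j : Fin (n + 1) // (j : ℕ) ≠ i} =>
    delta A (j.1 : ℕ) * x ^ (n - (j.1 : ℕ))) (Set.finite_range _).bddAbove
    ⟨⟨k, by omega⟩, hki⟩

lemma aux_essential_of {n : ℕ} (A : Matrix (Fin n) (Fin n) ℝ) (i : ℕ) (hi : 0 < i)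
    (h : ∃ x : ℝ, 0 < x ∧ ∀ k, k ≤ n → k ≠ i →
      delta A k * x ^ (n - k) < delta A i * x ^ (n - i)) : Essential A i := by
  obtain ⟨x, hx, h⟩ := h
  refine ⟨x, hx.le, ?_⟩
  haveI : Nonempty {j : Fin (n + 1) // (j : ℕ) ≠ i} := ⟨⟨0, by simp; omega⟩⟩
  obtain ⟨j, hj⟩ := exists_eq_ciSup_of_finite (f := fun j : {j : Fin (n + 1) // (j : ℕ) ≠ i} =>
    delta A (j.1 : ℕ) * x ^ (n - (j.1 : ℕ)))
  rw [← hj]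
  exact h _ (by omega) j.2

/-- Let `A ∈ M_n(ℝ₊)` with nondecreasing diagonal, and let
`0 = i_0 < i_1 < ⋯ < i_t ≤ n` (`t ≥ 1`, encoded by `e : Fin (t+1) → ℕ`) be such that
`i_1, …, i_t` are exactly the indices in `{1, …, n}` of the essential coefficients of
the characteristic maxpolynomial of `A`. Then for every `1 ≤ m ≤ t`:
`(δ_{i_m}/δ_{i_{m−1}})^{1/(i_m − i_{m−1})} ≥ a_{n−i_{m−1}, n−i_{m−1}}`. -/
theorem stmt_18 {n t : ℕ} (hn : 0 < n) (ht : 0 < t)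
    (A : Matrix (Fin n) (Fin n) ℝ) (hA : ∀ i j, 0 ≤ A i j)
    (hdiag : ∀ i j : Fin n, i ≤ j → A i i ≤ A j j)
    (e : Fin (t + 1) → ℕ) (he0 : e 0 = 0) (hmono : StrictMono e)
    (hen : e (Fin.last t) ≤ n)
    (hess : ∀ m : Fin t, Essential A (e m.succ))
    (honly : ∀ j : ℕ, 1 ≤ j → j ≤ n → Essential A j → ∃ m : Fin t, e m.succ = j) :
    ∀ m : Fin t,
      A ⟨n - 1 - e m.castSucc, by omega⟩ ⟨n - 1 - e m.castSucc, by omega⟩ ≤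
        (delta A (e m.succ) / delta A (e m.castSucc)) ^
          (((e m.succ - e m.castSucc : ℕ) : ℝ)⁻¹) := by
  intro m
  have hlt : e m.castSucc < e m.succ := hmono (Fin.castSucc_lt_succ)
  have hle : e m.succ ≤ n := le_trans (hmono.monotone (Fin.le_last _)) hen
  have hnn := aux_delta_nonneg A hA
  have hp : 0 < e m.castSucc → ∃ x : ℝ, 0 ≤ x ∧ ∀ k, k ≤ n → k ≠ e m.castSucc →
      delta A k * x ^ (n - k) < delta A (e m.castSucc) * x ^ (n - e m.castSucc) := by
    intro h0
    have hne : m.castSucc ≠ 0 := fun h => by rw [h, he0] at h0; omega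
    obtain ⟨m', hm'⟩ := Fin.exists_succ_eq.2 hne
    rw [← hm']
    exact aux_essential A _ (hess m')
  have hdp : 0 < delta A (e m.castSucc) := by
    rcases Nat.eq_zero_or_pos (e m.castSucc) with h0 | h0
    · rw [h0]; simp [delta]
    · obtain ⟨x, hx, h⟩ := hp h0
      have h1 := h 0 (by omega) (by omega)
      have h2 : 0 ≤ delta A 0 * x ^ (n - 0) := mul_nonneg (hnn 0) (by positivity)
      exact pos_of_mul_pos_left (h2.trans_lt h1) (by positivity)
  have h1 := aux_main n (delta A) hnn _ _ hlt hle hdp hp (aux_essential A _ (hess m)) (by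
    intro j hj1 hj2 hj
    obtain ⟨m', hm'⟩ := honly j (by omega) (by omega) (aux_essential_of A j (by omega) hj)
    rw [← hm'] at hj1 hj2
    have a1 := hmono.lt_iff_lt.1 hj1
    have a2 := hmono.lt_iff_lt.1 hj2
    simp only [Fin.lt_def, Fin.val_succ, Fin.val_castSucc] at a1 a2
    omega)
  have h2 := aux_step A hA hdiag (e m.castSucc) (by omega)
    ⟨n - 1 - e m.castSucc, by omega⟩ rfl
  exact le_of_mul_le_mul_left (h2.trans h1) hdp
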